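/- Let r > 0, let q = e^{−π√r}, and let k ∈ (0,1) satisfy K(√(1−k²)) = √r · K(k). Then η(q)^8 = (2^{8/3}/π⁴) · q^{−1/3} · k^{2/3} · (1−k²)^{4/3} · K(k)⁴. -/

import Mathlib

open Real

/-- Complete elliptic integral of the first kind. -/
noncomputable def ellK (x : ℝ) : ℝ :=
  ∫ θ in (0:ℝ)..(π/2), (1 - x ^ 2 * Real.sin θ ^ 2) ^ (-(1:ℝ)/2)

/-- The eta product `η(q) = ∏_{n≥1} (1 - q^n)` (real powers). -/
noncomputable def etaP (q : ℝ) : ℝ := ∏' n : ℕ, (1 - q ^ ((n : ℝ) + 1))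

/-- `A(a,p;q) = q^{p/12 - a/2 + a²/(2p)} ∏_{n≥1} (1 - q^{np+a})(1 - q^{np+p-a})`. -/
noncomputable def Afun (a p q : ℝ) : ℝ :=
  q ^ (p / 12 - a / 2 + a ^ 2 / (2 * p)) *
    ∏' n : ℕ, ((1 - q ^ (((n : ℝ) + 1) * p + a)) * (1 - q ^ (((n : ℝ) + 1) * p + p - a)))

/-- The reciprocal `1 / ((1 - p) ⋯ (1 - p ^ m))` of the `q`-Pochhammer symbol, extended by zero to
negative integers. -/
noncomputable def qPochInv (p : ℝ) (m : ℤ) : ℝ :=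
  if m < 0 then 0 else (∏ k ∈ Finset.range m.toNat, (1 - p ^ (k + 1)))⁻¹

lemma one_sub_pow_pos {p : ℝ} (hp0 : 0 < p) (hp1 : p < 1) (k : ℕ) : 0 < 1 - p ^ (k + 1) :=
  sub_pos.2 (pow_lt_one₀ hp0.le hp1 k.succ_ne_zero)

lemma qPochInv_nonneg {p : ℝ} (hp0 : 0 < p) (hp1 : p < 1) (m : ℤ) : 0 ≤ qPochInv p m := by
  unfold qPochInv
  split_ifs
  · exact le_rfl
  · exact inv_nonneg.2 (Finset.prod_nonneg fun k _ ↦ (one_sub_pow_pos hp0 hp1 k).le)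

lemma qPochInv_sub_one {p : ℝ} (hp0 : 0 < p) (hp1 : p < 1) (m : ℤ) :
    qPochInv p (m - 1) = (1 - p ^ m) * qPochInv p m := by
  unfold qPochInv
  rcases lt_trichotomy m 0 with h | rfl | h
  · simp [h, show m - 1 < 0 by omega]
  · simp
  · obtain ⟨n, rfl⟩ : ∃ n : ℕ, m = n + 1 := ⟨(m - 1).toNat, by omega⟩
    have h1 : ((n : ℤ) + 1).toNat = n + 1 := by omega
    have h2 : ((n : ℤ) + 1 - 1).toNat = n := by omega
    rw [if_neg (by omega), if_neg (by omega), h1, h2, Finset.prod_range_succ]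
    have := (one_sub_pow_pos hp0 hp1 n).ne'
    have e : p ^ ((n : ℤ) + 1) = p ^ (n + 1) := by exact_mod_cast zpow_natCast p (n + 1)
    rw [e, mul_inv, mul_comm (1 - _), mul_assoc, inv_mul_cancel₀ this, mul_one]

lemma summable_pow_affine {q : ℝ} (hq0 : 0 < q) (hq1 : q < 1) {a : ℕ} (ha : 0 < a) (b : ℕ) :
    Summable fun k : ℕ ↦ q ^ (a * k + b) := by
  simp_rw [pow_add, pow_mul]
  exact (summable_geometric_of_lt_one (by positivity)
    (pow_lt_one₀ hq0.le hq1 ha.ne')).mul_right _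

lemma multipliable_one_sub_pow_succ {p : ℝ} (hp0 : 0 < p) (hp1 : p < 1) :
    Multipliable fun k : ℕ ↦ 1 - p ^ (k + 1) := by
  simp_rw [sub_eq_add_neg]
  exact Real.multipliable_one_add_of_summable
    (by simpa using (summable_pow_affine hp0 hp1 one_pos 1).neg)

lemma tprod_one_sub_pow_succ_pos {p : ℝ} (hp0 : 0 < p) (hp1 : p < 1) :
    0 < ∏' k : ℕ, (1 - p ^ (k + 1)) := by
  have h : Summable fun k : ℕ ↦ Real.log (1 + -p ^ (k + 1)) :=
    Real.summable_log_one_add_of_summable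
      (by simpa using (summable_pow_affine hp0 hp1 one_pos 1).neg)
  rw [← Real.rexp_tsum_eq_tprod (one_sub_pow_pos hp0 hp1) (by simpa [sub_eq_add_neg] using h)]
  exact Real.exp_pos _

lemma tprod_le_prod_one_sub_pow {p : ℝ} (hp0 : 0 < p) (hp1 : p < 1) (n : ℕ) :
    ∏' k : ℕ, (1 - p ^ (k + 1)) ≤ ∏ k ∈ Finset.range n, (1 - p ^ (k + 1)) := by
  have ha : Antitone fun n ↦ ∏ k ∈ Finset.range n, (1 - p ^ (k + 1)) := by
    refine antitone_nat_of_succ_le fun n ↦ ?_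
    rw [Finset.prod_range_succ]
    exact mul_le_of_le_one_right
      (Finset.prod_nonneg fun k _ ↦ (one_sub_pow_pos hp0 hp1 k).le) (by
        linarith [pow_pos hp0 (n + 1)])
  exact ha.le_of_tendsto (multipliable_one_sub_pow_succ hp0 hp1).hasProd.tendsto_prod_nat n

lemma qPochInv_le {p : ℝ} (hp0 : 0 < p) (hp1 : p < 1) (m : ℤ) :
    qPochInv p m ≤ (∏' k : ℕ, (1 - p ^ (k + 1)))⁻¹ := by
  have h0 := tprod_one_sub_pow_succ_pos hp0 hp1
  unfold qPochInv
  split_ifs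
  · exact (inv_pos.2 h0).le
  · exact inv_anti₀ h0 (tprod_le_prod_one_sub_pow hp0 hp1 _)

open Filter Topology in
lemma tendsto_qPochInv {p : ℝ} (hp0 : 0 < p) (hp1 : p < 1) :
    Tendsto (qPochInv p) atTop (𝓝 (∏' k : ℕ, (1 - p ^ (k + 1)))⁻¹) := by
  have h1 : Tendsto Int.toNat atTop atTop :=
    tendsto_atTop_mono' atTop (f₁ := fun m : ℤ ↦ m.toNat) .rfl
      (tendsto_atTop_atTop.2 fun b ↦ ⟨b, fun a ha ↦ by omega⟩)
  have h2 := ((multipliable_one_sub_pow_succ hp0 hp1).hasProd.tendsto_prod_nat.comp h1).inv₀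
    (tprod_one_sub_pow_succ_pos hp0 hp1).ne'
  refine h2.congr' ?_
  filter_upwards [eventually_ge_atTop 0] with m hm
  simp [qPochInv, not_lt.2 hm]

/-- The coefficients of the finite Jacobi triple product, divided by a `q`-Pochhammer symbol. -/
noncomputable def jacobiCoeff (q : ℝ) (N n : ℤ) : ℝ :=
  q ^ (n ^ 2) * (qPochInv (q ^ 2) (N + n) * qPochInv (q ^ 2) (N - n))

lemma jacobiCoeff_succ {q : ℝ} (hq0 : 0 < q) (hq1 : q < 1) (N n : ℤ) :
    (1 - (q ^ 2) ^ (2 * N + 1)) * (1 - (q ^ 2) ^ (2 * N + 2)) * jacobiCoeff q (N + 1) n =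
      (1 + (q ^ (2 * N + 1)) ^ 2) * jacobiCoeff q N n +
        q ^ (2 * N + 1) * (jacobiCoeff q N (n - 1) + jacobiCoeff q N (n + 1)) := by
  have hp0 : 0 < q ^ 2 := by positivity
  have hp1 : q ^ 2 < 1 := pow_lt_one₀ hq0.le hq1 two_ne_zero
  have hs := qPochInv_sub_one hp0 hp1
  have e1 : qPochInv (q ^ 2) (N + n) =
      (1 - (q ^ 2) ^ (N + 1 + n)) * qPochInv (q ^ 2) (N + 1 + n) := by
    rw [← hs]; congr 1; ring
  have e2 : qPochInv (q ^ 2) (N - n) =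
      (1 - (q ^ 2) ^ (N + 1 - n)) * qPochInv (q ^ 2) (N + 1 - n) := by
    rw [← hs]; congr 1; ring
  have e3 : qPochInv (q ^ 2) (N + (n - 1)) =
      (1 - (q ^ 2) ^ (N + n)) * qPochInv (q ^ 2) (N + n) := by
    rw [← hs]; congr 1; ring
  have e4 : qPochInv (q ^ 2) (N - (n + 1)) =
      (1 - (q ^ 2) ^ (N - n)) * qPochInv (q ^ 2) (N - n) := by
    rw [← hs]; congr 1; ring
  have e5 : N - (n - 1) = N + 1 - n := by ring
  have e6 : N + (n + 1) = N + 1 + n := by ring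
  unfold jacobiCoeff
  rw [e3, e4, e5, e6, e1, e2]
  have hq := hq0.ne'
  have hz (m : ℤ) : (q ^ 2) ^ m = (q ^ m) ^ 2 := by
    rw [← zpow_natCast, ← zpow_natCast, ← zpow_mul, ← zpow_mul, mul_comm]
  have s1 : (n - 1) ^ 2 = n ^ 2 - n - n + 1 := by ring
  have s2 : (n + 1) ^ 2 = n ^ 2 + n + n + 1 := by ring
  simp only [hz, two_mul, s1, s2, zpow_add₀ hq, zpow_sub₀ hq, zpow_ofNat]
  generalize qPochInv _ _ = A
  generalize qPochInv _ _ = B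
  have := (zpow_pos hq0 n).ne'
  have := (zpow_pos hq0 N).ne'
  generalize q ^ n = x at *
  generalize q ^ N = u at *
  field_simp
  ring

lemma hasSum_jacobiCoeff {q : ℝ} (hq0 : 0 < q) (hq1 : q < 1) {z : ℝ} (hz : z ≠ 0) (N : ℕ) :
    HasSum (fun n : ℤ ↦ (∏ k ∈ Finset.range (2 * N), (1 - (q ^ 2) ^ (k + 1))) *
        (jacobiCoeff q N n * z ^ n))
      (∏ k ∈ Finset.range N, ((1 + q ^ (2 * k + 1) * z) * (1 + q ^ (2 * k + 1) / z))) := by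
  induction N with
  | zero =>
    have h : jacobiCoeff q 0 0 = 1 := by simp [jacobiCoeff, qPochInv]
    convert hasSum_single (f := fun n : ℤ ↦ (∏ k ∈ Finset.range (2 * 0), (1 - (q ^ 2) ^ (k + 1))) *
        (jacobiCoeff q ((0 : ℕ) : ℤ) n * z ^ n)) 0 fun n hn ↦ ?_ using 1
    · simp [h]
    · rcases lt_or_gt_of_ne hn with h | h <;> simp [jacobiCoeff, qPochInv, h]
  | succ N ih =>
    set P := ∏ k ∈ Finset.range (2 * N), (1 - (q ^ 2) ^ (k + 1)) with hP
    set T := ∏ k ∈ Finset.range N, ((1 + q ^ (2 * k + 1) * z) * (1 + q ^ (2 * k + 1) / z)) with hT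
    have h1 := (Equiv.subRight (1 : ℤ)).hasSum_iff.2 ih
    have h2 := (Equiv.addRight (1 : ℤ)).hasSum_iff.2 ih
    have h := (ih.mul_left (1 + (q ^ (2 * N + 1)) ^ 2)).add
      (((h1.mul_left z).add (h2.mul_left z⁻¹)).mul_left (q ^ (2 * N + 1)))
    rw [Finset.prod_range_succ, ← hT, show T * ((1 + q ^ (2 * N + 1) * z) *
      (1 + q ^ (2 * N + 1) / z)) = (1 + (q ^ (2 * N + 1)) ^ 2) * T +
        q ^ (2 * N + 1) * (z * T + z⁻¹ * T) by field_simp; ring]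
    refine h.congr_fun fun n ↦ ?_
    have hj := jacobiCoeff_succ hq0 hq1 N n
    have e1 : (q ^ 2) ^ (2 * (N : ℤ) + 1) = (q ^ 2) ^ (2 * N + 1) := by
      rw [← zpow_natCast (q ^ 2)]; push_cast; rfl
    have e2 : (q ^ 2) ^ (2 * (N : ℤ) + 2) = (q ^ 2) ^ (2 * N + 1 + 1) := by
      rw [← zpow_natCast (q ^ 2)]; push_cast; ring_nf
    have e3 : q ^ (2 * (N : ℤ) + 1) = q ^ (2 * N + 1) := by
      exact_mod_cast zpow_natCast q (2 * N + 1)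
    rw [e1, e2, e3] at hj
    rw [show 2 * (N + 1) = 2 * N + 1 + 1 by ring, Finset.prod_range_succ, Finset.prod_range_succ,
      ← hP]
    simp only [Function.comp_apply, Equiv.subRight_apply, Equiv.coe_addRight, zpow_add₀ hz,
      zpow_sub₀ hz, zpow_one]
    push_cast
    calc _ = P * ((1 - (q ^ 2) ^ (2 * N + 1)) * (1 - (q ^ 2) ^ (2 * N + 1 + 1)) *
          jacobiCoeff q (N + 1) n) * z ^ n := by ring
      _ = _ := by rw [hj]; field_simp

open Filter Topology in
/-- The Jacobi triple product identity. -/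
theorem jacobi_triple_product {q : ℝ} (hq0 : 0 < q) (hq1 : q < 1) {z : ℝ} (hz : z ≠ 0)
    {s : ℝ} (hs : HasSum (fun n : ℤ ↦ q ^ (n ^ 2) * z ^ n) s) :
    s = (∏' k : ℕ, (1 - (q ^ 2) ^ (k + 1))) *
      ((∏' k : ℕ, (1 + q ^ (2 * k + 1) * z)) * ∏' k : ℕ, (1 + q ^ (2 * k + 1) / z)) := by
  have hp0 : 0 < q ^ 2 := by positivity
  have hp1 : q ^ 2 < 1 := pow_lt_one₀ hq0.le hq1 two_ne_zero
  set E := ∏' k : ℕ, (1 - (q ^ 2) ^ (k + 1)) with hE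
  have hE0 : 0 < E := tprod_one_sub_pow_succ_pos hp0 hp1
  have hsq := summable_pow_affine hq0 hq1 two_pos 1
  have m1 : Multipliable fun k : ℕ ↦ (1 + q ^ (2 * k + 1) * z) :=
    Real.multipliable_one_add_of_summable (hsq.mul_right z)
  have m2 : Multipliable fun k : ℕ ↦ (1 + q ^ (2 * k + 1) / z) :=
    Real.multipliable_one_add_of_summable (hsq.div_const z)
  have hP : Tendsto (fun N : ℕ ↦ ∏ k ∈ Finset.range (2 * N), (1 - (q ^ 2) ^ (k + 1))) atTop (𝓝 E) :=
    (multipliable_one_sub_pow_succ hp0 hp1).hasProd.tendsto_prod_nat.comp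
      (tendsto_id.const_mul_atTop' two_pos)
  have hP1 (N : ℕ) : |∏ k ∈ Finset.range (2 * N), (1 - (q ^ 2) ^ (k + 1))| ≤ 1 := by
    rw [abs_of_nonneg (Finset.prod_nonneg fun k _ ↦ (one_sub_pow_pos hp0 hp1 k).le)]
    exact Finset.prod_le_one (fun k _ ↦ (one_sub_pow_pos hp0 hp1 k).le)
      fun k _ ↦ by linarith [pow_pos hp0 (k + 1)]
  have hlim (n : ℤ) : Tendsto (fun N : ℕ ↦ (∏ k ∈ Finset.range (2 * N), (1 - (q ^ 2) ^ (k + 1))) *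
      (jacobiCoeff q N n * z ^ n)) atTop (𝓝 (E⁻¹ * (q ^ (n ^ 2) * z ^ n))) := by
    have c : Tendsto (fun N : ℕ ↦ (N : ℤ)) atTop atTop := tendsto_natCast_atTop_atTop
    have a1 := (tendsto_qPochInv hp0 hp1).comp (tendsto_atTop_add_const_right _ n c)
    have a2 := (tendsto_qPochInv hp0 hp1).comp (tendsto_atTop_add_const_right _ (-n) c)
    have := hP.mul (((a1.mul a2).const_mul (q ^ (n ^ 2))).mul_const (z ^ n))
    convert this using 2
    · simp [jacobiCoeff, sub_eq_add_neg]
    · rw [← hE]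
      field_simp
  have hdom : Tendsto (fun N : ℕ ↦ ∑' n : ℤ, (∏ k ∈ Finset.range (2 * N), (1 - (q ^ 2) ^ (k + 1))) *
      (jacobiCoeff q N n * z ^ n)) atTop (𝓝 (∑' n : ℤ, E⁻¹ * (q ^ (n ^ 2) * z ^ n))) := by
    refine tendsto_tsum_of_dominated_convergence
      (bound := fun n : ℤ ↦ E⁻¹ * E⁻¹ * |q ^ (n ^ 2) * z ^ n|) (hs.summable.abs.mul_left _)
      hlim (.of_forall fun N n ↦ ?_)
    have b1 := qPochInv_le hp0 hp1 (N + n)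
    have b2 := qPochInv_le hp0 hp1 (N - n)
    have n1 := qPochInv_nonneg hp0 hp1 (N + n)
    have n2 := qPochInv_nonneg hp0 hp1 (N - n)
    rw [Real.norm_eq_abs, abs_mul]
    refine (mul_le_of_le_one_left (abs_nonneg _) (hP1 N)).trans ?_
    rw [show jacobiCoeff q N n * z ^ n = qPochInv (q ^ 2) (N + n) * qPochInv (q ^ 2) (N - n) *
      (q ^ (n ^ 2) * z ^ n) by rw [jacobiCoeff]; ring, abs_mul, abs_of_nonneg (mul_nonneg n1 n2)]
    gcongr
  simp_rw [(hasSum_jacobiCoeff hq0 hq1 hz _).tsum_eq, (hs.mul_left _).tsum_eq,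
    Finset.prod_mul_distrib] at hdom
  have := tendsto_nhds_unique hdom (m1.hasProd.tendsto_prod_nat.mul m2.hasProd.tendsto_prod_nat)
  rw [← this]
  field_simp

/-- The theta constant `θ₂` as a function of `t`, with nome `exp (-π t)`. -/
noncomputable def thetaTwo (t : ℝ) : ℝ := HurwitzZeta.evenKernel ((1 / 2 : ℝ) : UnitAddCircle) t

/-- The theta constant `θ₃` as a function of `t`, with nome `exp (-π t)`. -/
noncomputable def thetaThree (t : ℝ) : ℝ := HurwitzZeta.evenKernel ((0 : ℝ) : UnitAddCircle) t

/-- The theta constant `θ₄` as a function of `t`, with nome `exp (-π t)`. -/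
noncomputable def thetaFour (t : ℝ) : ℝ := HurwitzZeta.cosKernel ((1 / 2 : ℝ) : UnitAddCircle) t

lemma hasSum_thetaTwo {t : ℝ} (ht : 0 < t) :
    HasSum (fun n : ℤ ↦ rexp (-π * (n + 1 / 2) ^ 2 * t)) (thetaTwo t) :=
  HurwitzZeta.hasSum_int_evenKernel (1 / 2) ht

lemma hasSum_thetaThree {t : ℝ} (ht : 0 < t) :
    HasSum (fun n : ℤ ↦ rexp (-π * n ^ 2 * t)) (thetaThree t) := by
  simpa [thetaThree] using HurwitzZeta.hasSum_int_evenKernel 0 ht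

lemma hasSum_thetaFour {t : ℝ} (ht : 0 < t) :
    HasSum (fun n : ℤ ↦ (-1) ^ n * rexp (-π * n ^ 2 * t)) (thetaFour t) := by
  rw [← Complex.hasSum_ofReal]
  refine (HurwitzZeta.hasSum_int_cosKernel (1 / 2) ht).congr_fun fun n ↦ ?_
  rw [show 2 * (π : ℂ) * Complex.I * ((1 / 2 : ℝ) : ℂ) * n = n * (π * Complex.I) by
    push_cast; ring, Complex.exp_int_mul, Complex.exp_pi_mul_I]
  push_cast
  rfl

lemma thetaTwo_pos {t : ℝ} (ht : 0 < t) : 0 < thetaTwo t :=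
  (hasSum_thetaTwo ht).tsum_eq ▸
    (hasSum_thetaTwo ht).summable.tsum_pos (fun _ ↦ (exp_pos _).le) 0 (exp_pos _)

lemma thetaThree_pos {t : ℝ} (ht : 0 < t) : 0 < thetaThree t :=
  (hasSum_thetaThree ht).tsum_eq ▸
    (hasSum_thetaThree ht).summable.tsum_pos (fun _ ↦ (exp_pos _).le) 0 (exp_pos _)

lemma sqrt_mul_thetaTwo {t : ℝ} (ht : 0 < t) : √t * thetaTwo t = thetaFour (1 / t) := by
  have := Real.sqrt_pos.2 ht
  rw [thetaTwo, HurwitzZeta.evenKernel_functional_equation, ← Real.sqrt_eq_rpow, thetaFour]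
  field_simp

lemma sqrt_mul_thetaThree {t : ℝ} (ht : 0 < t) : √t * thetaThree t = thetaThree (1 / t) := by
  have := Real.sqrt_pos.2 ht
  rw [thetaThree, thetaThree, HurwitzZeta.evenKernel_functional_equation, ← Real.sqrt_eq_rpow,
    QuotientAddGroup.mk_zero, HurwitzZeta.evenKernel_eq_cosKernel_of_zero]
  field_simp

lemma thetaFour_pos {t : ℝ} (ht : 0 < t) : 0 < thetaFour t := by
  have h := sqrt_mul_thetaTwo (one_div_pos.2 ht)
  rw [one_div_one_div] at h
  rw [← h]
  exact mul_pos (Real.sqrt_pos.2 (one_div_pos.2 ht)) (thetaTwo_pos (one_div_pos.2 ht))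

open Filter Topology in
lemma tendsto_thetaThree : Tendsto thetaThree atTop (𝓝 1) := by
  obtain ⟨p, hp, h⟩ := HurwitzZeta.isBigO_atTop_evenKernel_sub ((0 : ℝ) : UnitAddCircle)
  have h2 := h.trans_tendsto (Real.tendsto_exp_atBot.comp (tendsto_id.const_mul_atTop_of_neg
    (neg_neg_of_pos hp)))
  simpa [thetaThree, Function.comp_def] using! h2.add_const 1

open Filter Topology in
lemma tendsto_thetaTwo : Tendsto thetaTwo atTop (𝓝 0) := by
  obtain ⟨p, hp, h⟩ := HurwitzZeta.isBigO_atTop_evenKernel_sub ((1 / 2 : ℝ) : UnitAddCircle)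
  have h2 := h.trans_tendsto (Real.tendsto_exp_atBot.comp (tendsto_id.const_mul_atTop_of_neg
    (neg_neg_of_pos hp)))
  have h0 : ((1 / 2 : ℝ) : UnitAddCircle) ≠ 0 := by
    rw [Ne, AddCircle.coe_eq_zero_iff]
    rintro ⟨n, hn⟩
    have : (2 * n : ℝ) = 1 := by simp at hn; linarith
    have : 2 * n = 1 := by exact_mod_cast this
    omega
  simp_rw [if_neg h0, sub_zero] at h2
  exact h2

lemma HasSum.split_parity {F : ℤ × ℤ → ℝ} {s a b : ℝ} (hF : HasSum F s)
    (ha : HasSum (fun p : ℤ × ℤ ↦ F (p.1 + p.2, p.1 - p.2)) a)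
    (hb : HasSum (fun p : ℤ × ℤ ↦ F (p.1 + p.2 + 1, p.1 - p.2)) b) : s = a + b := by
  have iu : Function.Injective fun p : ℤ × ℤ ↦ (p.1 + p.2, p.1 - p.2) := by
    rintro ⟨i, j⟩ ⟨k, l⟩ h
    simp only [Prod.mk.injEq] at h ⊢
    omega
  have iv : Function.Injective fun p : ℤ × ℤ ↦ (p.1 + p.2 + 1, p.1 - p.2) := by
    rintro ⟨i, j⟩ ⟨k, l⟩ h
    simp only [Prod.mk.injEq] at h ⊢
    omega
  refine hF.unique ((iu.hasSum_range_iff.2 ha).add_isCompl ?_ (iv.hasSum_range_iff.2 hb))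
  refine ⟨Set.disjoint_iff_inter_eq_empty.2 ?_, codisjoint_iff.2 ?_⟩
  · ext ⟨m, n⟩
    simp only [Set.mem_inter_iff, Set.mem_range, Prod.mk.injEq, Prod.exists,
      Set.mem_empty_iff_false, iff_false]
    rintro ⟨⟨i, j, h⟩, k, l, h'⟩
    omega
  · ext ⟨m, n⟩
    simp only [Set.sup_eq_union, Set.mem_union, Set.mem_range, Prod.mk.injEq, Prod.exists,
      Set.top_eq_univ, Set.mem_univ, iff_true]
    rcases Int.even_or_odd' (m + n) with ⟨c, h | h⟩
    · exact .inl ⟨c, m - c, by omega, by omega⟩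
    · exact .inr ⟨c, m - 1 - c, by omega, by omega⟩

lemma HasSum.mul_real {f g : ℤ → ℝ} {a b : ℝ} (hf : HasSum f a) (hg : HasSum g b) :
    HasSum (fun p : ℤ × ℤ ↦ f p.1 * g p.2) (a * b) :=
  hf.mul hg (summable_mul_of_summable_norm hf.summable.norm hg.summable.norm)

lemma mul_eq_add_of_hasSum {f g h₁ h₂ h₃ h₄ : ℤ → ℝ} {a b a₁ a₂ a₃ a₄ : ℝ}
    (hf : HasSum f a) (hg : HasSum g b) (hh₁ : HasSum h₁ a₁) (hh₂ : HasSum h₂ a₂)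
    (hh₃ : HasSum h₃ a₃) (hh₄ : HasSum h₄ a₄)
    (h : ∀ i j, f (i + j) * g (i - j) = h₁ i * h₂ j)
    (h' : ∀ i j, f (i + j + 1) * g (i - j) = h₃ i * h₄ j) :
    a * b = a₁ * a₂ + a₃ * a₄ :=
  (hf.mul_real hg).split_parity ((hh₁.mul_real hh₂).congr_fun fun p ↦ h p.1 p.2)
    ((hh₃.mul_real hh₄).congr_fun fun p ↦ h' p.1 p.2)

lemma thetaThree_sq {t : ℝ} (ht : 0 < t) :
    thetaThree t ^ 2 = thetaThree (2 * t) ^ 2 + thetaTwo (2 * t) ^ 2 := by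
  have h2 : 0 < 2 * t := by positivity
  simp only [sq]
  refine mul_eq_add_of_hasSum (hasSum_thetaThree ht) (hasSum_thetaThree ht)
    (hasSum_thetaThree h2) (hasSum_thetaThree h2) (hasSum_thetaTwo h2) (hasSum_thetaTwo h2)
    (fun i j ↦ ?_) fun i j ↦ ?_ <;>
  · simp only [← Real.exp_add]
    congr 1
    push_cast
    ring

lemma thetaFour_sq {t : ℝ} (ht : 0 < t) :
    thetaFour t ^ 2 = thetaThree (2 * t) ^ 2 - thetaTwo (2 * t) ^ 2 := by
  have h2 : 0 < 2 * t := by positivity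
  rw [sub_eq_add_neg, sq, sq, sq, ← neg_mul]
  refine mul_eq_add_of_hasSum (hasSum_thetaFour ht) (hasSum_thetaFour ht)
    (hasSum_thetaThree h2) (hasSum_thetaThree h2) (hasSum_thetaTwo h2).neg (hasSum_thetaTwo h2)
    (fun i j ↦ ?_) fun i j ↦ ?_
  · rw [mul_mul_mul_comm, ← Real.exp_add, ← Real.exp_add, ← zpow_add₀ (by norm_num),
      show i + j + (i - j) = 2 * i by ring, zpow_mul]
    simp only [even_two, Even.neg_zpow, one_zpow, one_mul]
    congr 1
    push_cast
    ring
  · rw [mul_mul_mul_comm, ← Real.exp_add, neg_mul (rexp _), ← Real.exp_add,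
      ← zpow_add₀ (by norm_num), show i + j + 1 + (i - j) = 2 * i + 1 by ring,
      zpow_add₀ (by norm_num), zpow_mul]
    simp only [even_two, Even.neg_zpow, one_zpow, one_mul, zpow_one, neg_mul]
    congr 2
    push_cast
    ring

lemma thetaTwo_sq {t : ℝ} (ht : 0 < t) :
    thetaTwo t ^ 2 = 2 * thetaTwo (2 * t) * thetaThree (2 * t) := by
  have h2 : 0 < 2 * t := by positivity
  have hs : HasSum (fun n : ℤ ↦ rexp (-π * (n + 1) ^ 2 * (2 * t))) (thetaThree (2 * t)) :=
    ((Equiv.addRight (1 : ℤ)).hasSum_iff.2 (hasSum_thetaThree h2)).congr_fun fun n ↦ by simp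
  rw [sq, mul_eq_add_of_hasSum (hasSum_thetaTwo ht) (hasSum_thetaTwo ht)
    (hasSum_thetaTwo h2) (hasSum_thetaThree h2) hs (hasSum_thetaTwo h2)
    (fun i j ↦ ?_) fun i j ↦ ?_]
  · ring
  all_goals
    simp only [← Real.exp_add]
    congr 1
    push_cast
    ring

lemma thetaThree_pow_four {t : ℝ} (ht : 0 < t) :
    thetaThree t ^ 4 = thetaTwo t ^ 4 + thetaFour t ^ 4 := by
  have h (x : ℝ) : x ^ 4 = (x ^ 2) ^ 2 := by ring
  rw [h, h (thetaTwo t), h (thetaFour t), thetaThree_sq ht, thetaTwo_sq ht, thetaFour_sq ht]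
  ring

lemma exp_neg_pi_mul_zpow (t : ℝ) (m : ℤ) : rexp (-π * t) ^ m = rexp (-π * m * t) := by
  rw [← Real.rpow_intCast, ← Real.exp_mul]
  ring_nf

/-- The product `θ₂⁴ θ₃⁴ θ₄¹⁶` in terms of the eta product with nome `q = exp (-π t)`. -/
lemma theta_prod_eq_eta_pow {t q : ℝ} (ht : 0 < t) (hq : q = rexp (-π * t)) :
    thetaTwo t ^ 4 * thetaThree t ^ 4 * thetaFour t ^ 16 =
      16 * q * (∏' k : ℕ, (1 - q ^ (k + 1))) ^ 24 := by
  have hq0 : 0 < q := hq ▸ exp_pos _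
  have hq1 : q < 1 := by
    rw [hq, Real.exp_lt_one_iff]
    nlinarith [mul_pos pi_pos ht]
  have hp0 : 0 < q ^ 2 := by positivity
  have hp1 : q ^ 2 < 1 := pow_lt_one₀ hq0.le hq1 two_ne_zero
  set E := ∏' k : ℕ, (1 - (q ^ 2) ^ (k + 1)) with hE
  have hE0 : 0 < E := tprod_one_sub_pow_succ_pos hp0 hp1
  set η := ∏' k : ℕ, (1 - q ^ (k + 1)) with hη
  set Q₁ := ∏' k : ℕ, (1 + q ^ (2 * k + 2)) with hQ₁
  set Q₂ := ∏' k : ℕ, (1 + q ^ (2 * k + 1)) with hQ₂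
  set Q₃ := ∏' k : ℕ, (1 - q ^ (2 * k + 1)) with hQ₃
  have madd (a b : ℕ) (ha : 0 < a) : Multipliable fun k : ℕ ↦ 1 + q ^ (a * k + b) :=
    Real.multipliable_one_add_of_summable (summable_pow_affine hq0 hq1 ha b)
  have msub (a b : ℕ) (ha : 0 < a) : Multipliable fun k : ℕ ↦ 1 - q ^ (a * k + b) := by
    simp_rw [sub_eq_add_neg]
    exact Real.multipliable_one_add_of_summable (summable_pow_affine hq0 hq1 ha b).neg
  have hEq : E = ∏' k : ℕ, (1 - q ^ (2 * k + 2)) := by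
    simp_rw [hE, ← pow_mul, mul_add]
  have h3 : thetaThree t = E * (Q₂ * Q₂) := by
    rw [jacobi_triple_product hq0 hq1 one_ne_zero ((hasSum_thetaThree ht).congr_fun fun n ↦ ?_)]
    · simp_rw [mul_one, div_one]
      rfl
    · rw [hq, exp_neg_pi_mul_zpow]
      simp
  have h4 : thetaFour t = E * (Q₃ * Q₃) := by
    rw [jacobi_triple_product hq0 hq1 (neg_ne_zero.2 one_ne_zero)
      ((hasSum_thetaFour ht).congr_fun fun n ↦ ?_)]
    · simp_rw [mul_neg, mul_one, div_neg, div_one, ← sub_eq_add_neg]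
      rfl
    · rw [hq, exp_neg_pi_mul_zpow]
      simp [mul_comm]
  have h2 : rexp (π * t / 4) * thetaTwo t = E * (Q₁ * (2 * Q₁)) := by
    rw [jacobi_triple_product hq0 hq1 hq0.ne'
      (((hasSum_thetaTwo ht).mul_left (rexp (π * t / 4))).congr_fun fun n ↦ ?_)]
    · have e : ∏' k : ℕ, (1 + q ^ (2 * k + 1) / q) = 2 * Q₁ := by
        simp_rw [pow_succ, mul_div_assoc, div_self hq0.ne', mul_one]
        have h := (madd 2 2 two_pos)
        rw [tprod_eq_zero_mul' (by simpa [mul_add] using h)]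
        simp only [mul_zero, pow_zero, mul_add, mul_one, hQ₁]
        norm_num
      have e' : ∏' k : ℕ, (1 + q ^ (2 * k + 1) * q) = Q₁ := by simp_rw [← pow_succ]; rfl
      rw [e, e']
    · rw [hq, exp_neg_pi_mul_zpow, exp_neg_pi_mul_zpow, ← Real.exp_add, ← Real.exp_add]
      congr 1
      push_cast
      ring
  have hη3 : Q₃ * E = η := by
    rw [hEq, hη, ← tprod_even_mul_odd (f := fun k ↦ 1 - q ^ (k + 1)) (msub 2 1 two_pos)
      (by simpa [add_assoc] using msub 2 2 two_pos)]
  have h12 : Q₂ * Q₁ = ∏' k : ℕ, (1 + q ^ (k + 1)) := by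
    rw [← tprod_even_mul_odd (f := fun k ↦ 1 + q ^ (k + 1)) (madd 2 1 two_pos)
      (by simpa [add_assoc] using madd 2 2 two_pos)]
  have hη12 : η * (Q₂ * Q₁) = E := by
    rw [h12, hη, hE, ← Multipliable.tprod_mul (by simpa using msub 1 1 one_pos)
      (by simpa using madd 1 1 one_pos)]
    congr 1
    funext k
    ring
  have hQ : Q₁ * Q₂ * Q₃ = 1 := by
    refine mul_left_cancel₀ hE0.ne' ?_
    linear_combination hη12 + Q₁ * Q₂ * hη3
  have h2' : thetaTwo t ^ 4 = 16 * q * E ^ 4 * Q₁ ^ 8 := by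
    have e : rexp (π * t / 4) ^ 4 * q = 1 := by
      rw [hq, ← Real.exp_nat_mul, ← Real.exp_add, Real.exp_eq_one_iff]
      push_cast
      ring
    have := congrArg (fun x : ℝ ↦ x ^ 4) h2
    linear_combination q * this - thetaTwo t ^ 4 * e
  rw [h2', h3, h4, ← hη3]
  linear_combination 16 * q * E ^ 24 * Q₃ ^ 24 *
    congrArg (fun x : ℝ ↦ x ^ 8) hQ

lemma rpow_neg_one_div_two {x : ℝ} (hx : 0 ≤ x) : x ^ (-(1 : ℝ) / 2) = (√x)⁻¹ := by
  rw [neg_div, Real.rpow_neg hx, ← Real.sqrt_eq_rpow]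

lemma one_sub_sq_mul_sin_sq_pos {x : ℝ} (h0 : 0 ≤ x) (h1 : x < 1) (θ : ℝ) :
    0 < 1 - x ^ 2 * Real.sin θ ^ 2 := by
  have := Real.sin_sq_le_one θ
  nlinarith [sq_nonneg x, sq_nonneg (Real.sin θ)]

lemma continuous_ellK_integrand {x : ℝ} (h0 : 0 ≤ x) (h1 : x < 1) :
    Continuous fun θ : ℝ ↦ (1 - x ^ 2 * Real.sin θ ^ 2) ^ (-(1 : ℝ) / 2) :=
  Continuous.rpow_const (by fun_prop) fun θ ↦ .inl (one_sub_sq_mul_sin_sq_pos h0 h1 θ).ne'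

lemma ellK_zero : ellK 0 = π / 2 := by simp [ellK]

lemma ellK_lt_ellK {x y : ℝ} (h0 : 0 ≤ x) (hxy : x < y) (h1 : y < 1) : ellK x < ellK y := by
  have hsq : x ^ 2 < y ^ 2 := pow_lt_pow_left₀ hxy h0 two_ne_zero
  refine intervalIntegral.integral_lt_integral_of_continuousOn_of_le_of_exists_lt
    (by positivity) (continuous_ellK_integrand h0 (hxy.trans h1)).continuousOn
    (continuous_ellK_integrand (h0.trans hxy.le) h1).continuousOn (fun θ _ ↦ ?_)
    ⟨π / 2, ⟨by positivity, le_rfl⟩, ?_⟩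
  · refine Real.rpow_le_rpow_of_nonpos (one_sub_sq_mul_sin_sq_pos (h0.trans hxy.le) h1 θ) ?_
      (by norm_num)
    gcongr
  · refine Real.rpow_lt_rpow_of_neg (one_sub_sq_mul_sin_sq_pos (h0.trans hxy.le) h1 _) ?_
      (by norm_num)
    rw [Real.sin_pi_div_two]
    linarith

lemma ellK_le {x : ℝ} (h0 : 0 ≤ x) (h1 : x < 1) :
    ellK x ≤ π / 2 * (1 - x ^ 2) ^ (-(1 : ℝ) / 2) := by
  have h : ellK x ≤ ∫ _ in (0 : ℝ)..(π / 2), (1 - x ^ 2) ^ (-(1 : ℝ) / 2) := by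
    refine intervalIntegral.integral_mono_on (by positivity)
      ((continuous_ellK_integrand h0 h1).intervalIntegrable _ _) (by simp) fun θ _ ↦ ?_
    refine Real.rpow_le_rpow_of_nonpos (by nlinarith) ?_ (by norm_num)
    nlinarith [Real.sin_sq_le_one θ, sq_nonneg x]
  simpa using h

open Filter Topology in
lemma tendsto_ellK_of_tendsto_zero {u : ℕ → ℝ} (h0 : ∀ n, 0 < u n) (h1 : ∀ n, u n < 1)
    (hu : Tendsto u atTop (𝓝 0)) : Tendsto (fun n ↦ ellK (u n)) atTop (𝓝 (π / 2)) := by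
  have hc : ContinuousAt (fun x : ℝ ↦ π / 2 * (1 - x ^ 2) ^ (-(1 : ℝ) / 2)) 0 := by
    refine continuousAt_const.mul (ContinuousAt.rpow_const (by fun_prop) (.inl (by simp)))
  have hl := hc.tendsto.comp hu
  simp only [ne_eq, OfNat.ofNat_ne_zero, not_false_eq_true, zero_pow, sub_zero, Real.one_rpow,
    mul_one] at hl
  exact tendsto_of_tendsto_of_tendsto_of_le_of_le tendsto_const_nhds hl
    (fun n ↦ ellK_zero ▸ (ellK_lt_ellK le_rfl (h0 n) (h1 n)).le)
    fun n ↦ ellK_le (h0 n).le (h1 n)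

open Set MeasureTheory in
/-- The ascending Landen transformation. -/
theorem ellK_landen {s : ℝ} (h0 : 0 ≤ s) (h1 : s < 1) :
    ellK (2 * s / (1 + s ^ 2)) = (1 + s ^ 2) * ellK (s ^ 2) := by
  set m := s ^ 2 with hm
  have hm0 : 0 ≤ m := sq_nonneg s
  have hm1 : m < 1 := pow_lt_one₀ h0 h1 two_ne_zero
  set k := 2 * s / (1 + m) with hk
  have hk0 : 0 ≤ k := by positivity
  have hk1 : k < 1 := by
    rw [hk, div_lt_one (by positivity), hm]
    nlinarith [sq_pos_of_pos (sub_pos.2 h1)]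
  have hk2 : k ^ 2 = 4 * m / (1 + m) ^ 2 := by rw [hk, div_pow, mul_pow, ← hm]; norm_num
  have hD (φ : ℝ) : 0 < 1 + m * Real.sin φ ^ 2 := by positivity
  have hm2 (φ : ℝ) : 0 < 1 - m ^ 2 * Real.sin φ ^ 2 := one_sub_sq_mul_sin_sq_pos hm0 hm1 φ
  set a : ℝ → ℝ := fun φ ↦ (1 + m) * Real.sin φ / (1 + m * Real.sin φ ^ 2) with ha
  set f : ℝ → ℝ := fun φ ↦ Real.arcsin (a φ) with hf
  set f' : ℝ → ℝ := fun φ ↦ (1 + m) * (1 - m * Real.sin φ ^ 2) /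
    ((1 + m * Real.sin φ ^ 2) * √(1 - m ^ 2 * Real.sin φ ^ 2)) with hf'
  set g : ℝ → ℝ := fun θ ↦ (1 - k ^ 2 * Real.sin θ ^ 2) ^ (-(1 : ℝ) / 2) with hg
  have ac : Continuous a := by
    refine Continuous.div (by fun_prop) (by fun_prop) fun φ ↦ (hD φ).ne'
  have fc : Continuous f := Real.continuous_arcsin.comp ac
  have f'c : Continuous f' := by
    refine Continuous.div (by fun_prop) (by fun_prop) fun φ ↦ ?_
    exact (mul_pos (hD φ) (Real.sqrt_pos.2 (hm2 φ))).ne'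
  have gc : Continuous g := continuous_ellK_integrand hk0 hk1
  have cos_sq (φ : ℝ) : 1 - a φ ^ 2 =
      Real.cos φ ^ 2 * (1 - m ^ 2 * Real.sin φ ^ 2) / (1 + m * Real.sin φ ^ 2) ^ 2 := by
    have := (hD φ).ne'
    rw [ha, Real.cos_sq']
    field_simp
    ring
  have a_le (φ : ℝ) : a φ ^ 2 ≤ 1 := by
    have : 0 ≤ 1 - a φ ^ 2 := by
      rw [cos_sq]
      have := (hm2 φ).le
      positivity
    linarith
  have sin_f (φ : ℝ) : Real.sin (f φ) = a φ :=
    Real.sin_arcsin (abs_le_one_iff_mul_self_le_one.2 (by nlinarith [a_le φ]) |> abs_le.1).1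
      (abs_le_one_iff_mul_self_le_one.2 (by nlinarith [a_le φ]) |> abs_le.1).2
  have hderiv : ∀ φ ∈ Ioo (min 0 (π / 2)) (max 0 (π / 2)),
      HasDerivWithinAt f (f' φ) (Ioi φ) φ := by
    intro φ hφ
    rw [min_eq_left (by positivity), max_eq_right (by positivity)] at hφ
    have hcos : 0 < Real.cos φ := Real.cos_pos_of_mem_Ioo ⟨by linarith [hφ.1, pi_pos], hφ.2⟩
    have hlt : 0 < 1 - a φ ^ 2 := by
      rw [cos_sq]
      have := hm2 φ
      have := hD φ
      positivity
    have hda : HasDerivAt a ((1 + m) * (1 - m * Real.sin φ ^ 2) * Real.cos φ /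
        (1 + m * Real.sin φ ^ 2) ^ 2) φ := by
      have hs := Real.hasDerivAt_sin φ
      have := (hs.const_mul (1 + m)).div (((hs.pow 2).const_mul m).const_add 1) (hD φ).ne'
      refine this.congr_deriv ?_
      simp only [Pi.pow_apply, Nat.cast_ofNat, Nat.add_one_sub_one, pow_one]
      ring
    have := ((Real.hasDerivAt_arcsin (by nlinarith) (by nlinarith)).comp φ hda).hasDerivWithinAt
      (s := Ioi φ)
    refine this.congr_deriv ?_
    rw [cos_sq, Real.sqrt_div' _ (by positivity), Real.sqrt_mul (by positivity),
      Real.sqrt_sq hcos.le, Real.sqrt_sq (hD φ).le, hf']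
    have := (hD φ).ne'
    have := (Real.sqrt_pos.2 (hm2 φ)).ne'
    field_simp
  have key := intervalIntegral.integral_comp_mul_deriv''' (a := 0) (b := π / 2) (f := f)
    (f' := f') (g := g) fc.continuousOn hderiv gc.continuousOn
    (gc.continuousOn.integrableOn_compact (isCompact_uIcc.image fc))
    (((gc.comp fc).mul f'c).continuousOn.integrableOn_compact isCompact_uIcc)
  have hf0 : f 0 = 0 := by simp [hf, ha]
  have hf1 : f (π / 2) = π / 2 := by
    have : (1 + m) ≠ 0 := by positivity
    simp [hf, ha, this]
  rw [hf0, hf1] at key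
  rw [ellK, ellK, ← intervalIntegral.integral_const_mul]
  refine key.symm.trans (intervalIntegral.integral_congr fun φ _ ↦ ?_)
  have hms : 0 < 1 - m * Real.sin φ ^ 2 := by
    nlinarith [Real.sin_sq_le_one φ, sq_nonneg (Real.sin φ)]
  have e : 1 - k ^ 2 * a φ ^ 2 = ((1 - m * Real.sin φ ^ 2) / (1 + m * Real.sin φ ^ 2)) ^ 2 := by
    have := (hD φ).ne'
    rw [hk2, ha]
    field_simp
    ring
  simp only [Function.comp_apply, hg, sin_f, e]
  rw [rpow_neg_one_div_two (sq_nonneg _), rpow_neg_one_div_two (hm2 φ).le,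
    Real.sqrt_sq (div_nonneg hms.le (hD φ).le), hf']
  have := (hD φ).ne'
  have := (Real.sqrt_pos.2 (hm2 φ)).ne'
  field_simp

/-- The elliptic modulus `θ₂² / θ₃²`. -/
noncomputable def thetaModulus (t : ℝ) : ℝ := thetaTwo t ^ 2 / thetaThree t ^ 2

lemma thetaModulus_pos {t : ℝ} (ht : 0 < t) : 0 < thetaModulus t :=
  div_pos (pow_pos (thetaTwo_pos ht) 2) (pow_pos (thetaThree_pos ht) 2)

lemma one_sub_thetaModulus_sq {t : ℝ} (ht : 0 < t) :
    1 - thetaModulus t ^ 2 = (thetaFour t ^ 2 / thetaThree t ^ 2) ^ 2 := by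
  have h3 := (thetaThree_pos ht).ne'
  have h := thetaThree_pow_four ht
  rw [thetaModulus]
  field_simp
  linarith

lemma thetaTwo_lt_thetaThree {t : ℝ} (ht : 0 < t) : thetaTwo t < thetaThree t := by
  refine lt_of_pow_lt_pow_left₀ 4 (thetaThree_pos ht).le ?_
  rw [thetaThree_pow_four ht]
  linarith [pow_pos (thetaFour_pos ht) 4]

lemma thetaModulus_lt_one {t : ℝ} (ht : 0 < t) : thetaModulus t < 1 := by
  rw [thetaModulus, div_lt_one (pow_pos (thetaThree_pos ht) 2)]
  exact pow_lt_pow_left₀ (thetaTwo_lt_thetaThree ht) (thetaTwo_pos ht).le two_ne_zero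

lemma ellK_thetaModulus_div {t : ℝ} (ht : 0 < t) :
    ellK (thetaModulus t) / thetaThree t ^ 2 =
      ellK (thetaModulus (2 * t)) / thetaThree (2 * t) ^ 2 := by
  have ht' : 0 < 2 * t := by positivity
  have h2 := thetaTwo_pos ht'
  have h3 := thetaThree_pos ht'
  have h3' := thetaThree_pos ht
  have hl := ellK_landen (s := thetaTwo (2 * t) / thetaThree (2 * t)) (by positivity)
    ((div_lt_one h3).2 (thetaTwo_lt_thetaThree ht'))
  have e1 : 1 + (thetaTwo (2 * t) / thetaThree (2 * t)) ^ 2 =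
      thetaThree t ^ 2 / thetaThree (2 * t) ^ 2 := by
    rw [thetaThree_sq ht]
    field_simp
  have e2 : 2 * (thetaTwo (2 * t) / thetaThree (2 * t)) /
      (thetaThree t ^ 2 / thetaThree (2 * t) ^ 2) = thetaModulus t := by
    rw [thetaModulus, thetaTwo_sq ht]
    field_simp
  rw [e1, e2, div_pow] at hl
  rw [hl, ← thetaModulus]
  field_simp

open Filter Topology in
theorem ellK_thetaModulus {t : ℝ} (ht : 0 < t) :
    ellK (thetaModulus t) = π / 2 * thetaThree t ^ 2 := by
  have hpos (n : ℕ) : 0 < 2 ^ n * t := by positivity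
  have hiter (n : ℕ) : ellK (thetaModulus (2 ^ n * t)) / thetaThree (2 ^ n * t) ^ 2 =
      ellK (thetaModulus t) / thetaThree t ^ 2 := by
    induction n with
    | zero => simp
    | succ n ih => rw [pow_succ', mul_assoc, ← ellK_thetaModulus_div (hpos n), ih]
  have ht2 : Tendsto (fun n : ℕ ↦ 2 ^ n * t) atTop atTop :=
    (tendsto_pow_atTop_atTop_of_one_lt one_lt_two).atTop_mul_const ht
  have h3 := (tendsto_thetaThree.comp ht2).pow 2
  have hm : Tendsto (fun n : ℕ ↦ thetaModulus (2 ^ n * t)) atTop (𝓝 0) := by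
    have h := ((tendsto_thetaTwo.comp ht2).pow 2).div h3 (by norm_num)
    rwa [zero_pow two_ne_zero, zero_div] at h
  have hl := (tendsto_ellK_of_tendsto_zero (fun n ↦ thetaModulus_pos (hpos n))
    (fun n ↦ thetaModulus_lt_one (hpos n)) hm).div h3 (by norm_num)
  simp only [one_pow, div_one] at hl
  have := tendsto_nhds_unique (hl.congr hiter) tendsto_const_nhds
  rw [this, div_mul_cancel₀ _ (pow_pos (thetaThree_pos ht) 2).ne']

lemma sqrt_one_sub_thetaModulus_sq {t : ℝ} (ht : 0 < t) :
    √(1 - thetaModulus t ^ 2) = thetaModulus (1 / t) := by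
  have ht' : 0 < 1 / t := by positivity
  have h2 := sqrt_mul_thetaTwo ht'
  have h3 := sqrt_mul_thetaThree ht'
  rw [one_div_one_div] at h2 h3
  have hs := Real.sqrt_pos.2 ht'
  have h3' := thetaThree_pos ht'
  rw [one_sub_thetaModulus_sq ht, Real.sqrt_sq (by positivity), ← h2, ← h3, thetaModulus]
  field_simp

lemma ellK_sqrt_one_sub_thetaModulus_sq {t : ℝ} (ht : 0 < t) :
    ellK √(1 - thetaModulus t ^ 2) = t * ellK (thetaModulus t) := by
  rw [sqrt_one_sub_thetaModulus_sq ht, ellK_thetaModulus ht,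
    ellK_thetaModulus (one_div_pos.2 ht), ← sqrt_mul_thetaThree ht, mul_pow, Real.sq_sqrt ht.le]
  ring

lemma sqrt_one_sub_sq_lt {x y : ℝ} (h0 : 0 < x) (hxy : x < y) (h1 : y < 1) :
    √(1 - y ^ 2) < √(1 - x ^ 2) ∧ √(1 - x ^ 2) < 1 := by
  have hsq : x ^ 2 < y ^ 2 := pow_lt_pow_left₀ hxy h0.le two_ne_zero
  refine ⟨Real.sqrt_lt_sqrt (by nlinarith) (by linarith), ?_⟩
  rw [Real.sqrt_lt' one_pos]
  nlinarith

lemma not_lt_of_ellK_sqrt_eq {c x y : ℝ} (hc : 0 < c) (h0 : 0 < x) (h1 : y < 1)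
    (hx : ellK √(1 - x ^ 2) = c * ellK x) (hy : ellK √(1 - y ^ 2) = c * ellK y) : ¬ x < y := by
  intro hxy
  obtain ⟨h2, h3⟩ := sqrt_one_sub_sq_lt h0 hxy h1
  have h4 := ellK_lt_ellK (Real.sqrt_nonneg _) h2 h3
  rw [hx, hy] at h4
  exact (mul_lt_mul_of_pos_left (ellK_lt_ellK h0.le hxy h1) hc).not_gt h4

/-- The singular modulus is a quotient of theta constants. -/
theorem eq_thetaModulus {t k : ℝ} (ht : 0 < t) (hk0 : 0 < k) (hk1 : k < 1)
    (hk : ellK √(1 - k ^ 2) = t * ellK k) : k = thetaModulus t :=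
  have h := ellK_sqrt_one_sub_thetaModulus_sq ht
  le_antisymm (not_lt.1 (not_lt_of_ellK_sqrt_eq ht (thetaModulus_pos ht) hk1 h hk))
    (not_lt.1 (not_lt_of_ellK_sqrt_eq ht hk0 (thetaModulus_lt_one ht) hk h))

lemma etaP_eq_tprod_pow (q : ℝ) : etaP q = ∏' n : ℕ, (1 - q ^ (n + 1)) := by
  refine tprod_congr fun n ↦ ?_
  rw [← Nat.cast_add_one, Real.rpow_natCast]

theorem stmt3 (r : ℝ) (hr : 0 < r) (q : ℝ) (hq : q = Real.exp (-π * Real.sqrt r))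
    (k : ℝ) (hk0 : 0 < k) (hk1 : k < 1)
    (hk : ellK (Real.sqrt (1 - k ^ 2)) = Real.sqrt r * ellK k) :
    etaP q ^ 8 =
      2 ^ ((8 : ℝ) / 3) / π ^ 4 * q ^ (-(1 : ℝ) / 3) * k ^ ((2 : ℝ) / 3) *
        (1 - k ^ 2) ^ ((4 : ℝ) / 3) * ellK k ^ 4 := by
  have ht : 0 < √r := Real.sqrt_pos.2 hr
  have hq0 : 0 < q := hq ▸ Real.exp_pos _
  have hk2 : 0 < 1 - k ^ 2 := by nlinarith
  have hkm := eq_thetaModulus ht hk0 hk1 hk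
  have hK : ellK k = π / 2 * thetaThree √r ^ 2 := by rw [hkm, ellK_thetaModulus ht]
  have hk' := one_sub_thetaModulus_sq ht
  rw [← hkm] at hk'
  have hprod := theta_prod_eq_eta_pow ht hq
  rw [← etaP_eq_tprod_pow] at hprod
  have h3 := thetaThree_pos ht
  have rpow_cube {x : ℝ} (hx : 0 ≤ x) (y : ℝ) : (x ^ y) ^ 3 = x ^ (y * 3) := by
    rw [Real.rpow_mul hx, Real.rpow_ofNat]
  refine (pow_left_inj₀ (by positivity) (by positivity) three_ne_zero).1 ?_
  rw [mul_pow, mul_pow, mul_pow, mul_pow, div_pow, rpow_cube hq0.le, rpow_cube hk0.le,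
    rpow_cube hk2.le, rpow_cube zero_le_two, div_mul_cancel₀ _ three_ne_zero,
    div_mul_cancel₀ _ three_ne_zero, div_mul_cancel₀ _ three_ne_zero,
    div_mul_cancel₀ _ three_ne_zero, Real.rpow_neg_one, Real.rpow_ofNat, Real.rpow_ofNat,
    Real.rpow_ofNat, hk', hK, hkm, thetaModulus]
  have hprod' : etaP q ^ 24 =
      thetaTwo √r ^ 4 * thetaThree √r ^ 4 * thetaFour √r ^ 16 / (16 * q) := by
    rw [hprod]
    field_simp
  rw [← pow_mul, hprod']
  field_simp
  norm_num
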